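/- Assume G is a good normal subgroup of W~ and identify W with its image in GL(V). Then the quotient map q : W~ -> W sends every reflection of W~ either to the identity or to a reflection of V. More precisely, if s is a reflection of W~ of order r with reflecting hyperplane H, then q(s) is the identity if r divides e_H, and otherwise q(s) is a reflection of V of order r/gcd(r, e_H) whose determinant on V equals det(s)^{e_H}. -/

import Mathlib

open MvPolynomial

noncomputable section

namespace ReflQuot

variable {k : Type} [Field k]

/-- The action of an invertible matrix `g` on polynomial functions on `k^n`:
the linear form `X i` is sent to `∑ j, (g⁻¹) i j • X j`, so that
`(g • f) (v) = f (g⁻¹ ⬝ v)`. -/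
def matAct {n : ℕ} (g : Matrix.GeneralLinearGroup (Fin n) k) :
    MvPolynomial (Fin n) k →ₐ[k] MvPolynomial (Fin n) k :=
  aeval fun i => ∑ j, ((↑(g⁻¹) : Matrix (Fin n) (Fin n) k) i j) • X j

/-- The algebra endomorphism of `k[X_1,…,X_m]` sending `X i` to `∑ j, M i j • X j`. -/
def polyAct {m : ℕ} (M : Fin m → Fin m → k) :
    MvPolynomial (Fin m) k →ₐ[k] MvPolynomial (Fin m) k :=
  aeval fun i => ∑ j, M i j • X j

/-- A reflection: an automorphism of finite order whose fixed-point subspace is a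
hyperplane. -/
def IsReflection {n : ℕ} (M : Matrix (Fin n) (Fin n) k) : Prop :=
  IsOfFinOrder M ∧
    Module.finrank k (LinearMap.ker (Matrix.toLin' M - LinearMap.id)) + 1 = n

/-- A double reflection: finite order, fixed points of codimension 2. -/
def IsDoubleReflection {n : ℕ} (M : Matrix (Fin n) (Fin n) k) : Prop :=
  IsOfFinOrder M ∧
    Module.finrank k (LinearMap.ker (Matrix.toLin' M - LinearMap.id)) + 2 = n

/-- A reflection group: a group generated by its reflections. -/
def IsReflectionGroup {n : ℕ} (W : Subgroup (Matrix.GeneralLinearGroup (Fin n) k)) : Prop :=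
  Subgroup.closure {g | g ∈ W ∧ IsReflection ((g : Matrix (Fin n) (Fin n) k))} = W

/-- The algebra of `G`-invariant polynomials. -/
def invariants {n : ℕ} (G : Subgroup (Matrix.GeneralLinearGroup (Fin n) k)) :
    Subalgebra k (MvPolynomial (Fin n) k) where
  carrier := {f | ∀ g ∈ G, matAct g f = f}
  mul_mem' := fun {a b} ha hb g hg => by
    rw [map_mul, ha g hg, hb g hg]
  one_mem' := fun g _ => map_one (matAct g)
  add_mem' := fun {a b} ha hb g hg => by
    rw [map_add, ha g hg, hb g hg]
  zero_mem' := fun g _ => map_zero (matAct g)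
  algebraMap_mem' := fun r g _ => (matAct g).commutes r

/-- The linear span of products of two positive-degree invariants, i.e. `(B^G_+)^2`. -/
def sqSpan {n : ℕ} (G : Subgroup (Matrix.GeneralLinearGroup (Fin n) k)) :
    Submodule k (MvPolynomial (Fin n) k) :=
  Submodule.span k {f | ∃ u ∈ invariants G, ∃ v ∈ invariants G,
    constantCoeff u = 0 ∧ constantCoeff v = 0 ∧ f = u * v}

/-- The ideal of positive-degree elements of the polynomial ring. -/
def idealPlus (k : Type) [Field k] (m : ℕ) : Ideal (MvPolynomial (Fin m) k) :=
  Ideal.span (Set.range X)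

/-- The ideal `I` of relations between the generators `p i` of the invariant algebra:
the kernel of `k[V] = k[X_1,…,X_m] → B^G`, `X i ↦ p i`. -/
def relIdeal {n m : ℕ} (p : Fin m → MvPolynomial (Fin n) k) :
    Ideal (MvPolynomial (Fin m) k) :=
  RingHom.ker (aeval p : MvPolynomial (Fin m) k →ₐ[k] MvPolynomial (Fin n) k)

/-- The context: `Wt` is a finite reflection group on `k^n`, `G` a normal subgroup of `Wt`,
`p` a minimal system of homogeneous generators (of degrees `d`) of the invariant algebra
`B^G` whose span is `Wt`-stable (i.e. a graded `W`-equivariant section of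
`B^G_+ → B^G_+/(B^G_+)^2`), and `c w` the matrix of the action of `w` on the span of the
`p i`, giving the induced action of `W = Wt/G` on `V = k^m`. -/
structure QuotSetup {n m : ℕ} (Wt G : Subgroup (Matrix.GeneralLinearGroup (Fin n) k))
    (p : Fin m → MvPolynomial (Fin n) k) (d : Fin m → ℕ)
    (c : ↥Wt → Fin m → Fin m → k) : Prop where
  finite : (Wt : Set (Matrix.GeneralLinearGroup (Fin n) k)).Finite
  reflGroup : IsReflectionGroup Wt
  le : G ≤ Wt
  normal : ∀ w ∈ Wt, ∀ g ∈ G, w * g * w⁻¹ ∈ G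
  homog : ∀ i, (p i).IsHomogeneous (d i)
  dpos : ∀ i, 0 < d i
  gen : Algebra.adjoin k (Set.range p) = invariants G
  minimal : ∀ a : Fin m → k, (∑ i, a i • p i) ∈ sqSpan G → a = 0
  equivar : ∀ (w : ↥Wt) (i), matAct (w : Matrix.GeneralLinearGroup (Fin n) k) (p i)
      = ∑ j, c w i j • p j

/-- `W = Wt/G` acts trivially on the conormal module `I/(A_+ I)`. -/
def TrivialConormal {n m : ℕ} (Wt : Subgroup (Matrix.GeneralLinearGroup (Fin n) k))
    (p : Fin m → MvPolynomial (Fin n) k) (c : ↥Wt → Fin m → Fin m → k) : Prop :=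
  ∀ w : ↥Wt, ∀ f ∈ relIdeal p, polyAct (c w) f - f ∈ idealPlus k m * relIdeal p

/-- `G` is of complete intersection: `I` is generated by `dim V - dim Vt = m - n` elements. -/
def IsCompleteIntersection {n m : ℕ} (p : Fin m → MvPolynomial (Fin n) k) : Prop :=
  ∃ s : Finset (MvPolynomial (Fin m) k), s.card = m - n ∧ Ideal.span (s : Set _) = relIdeal p

/-- `G` is a good normal subgroup of `Wt`. -/
def IsGoodQuot {n m : ℕ} (Wt : Subgroup (Matrix.GeneralLinearGroup (Fin n) k))
    (p : Fin m → MvPolynomial (Fin n) k) (c : ↥Wt → Fin m → Fin m → k) : Prop :=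
  IsCompleteIntersection p ∧ TrivialConormal Wt p c


/-- The pointwise stabilizer of a subspace `L` in `GL_n(k)`. -/
def pointStab {n : ℕ} (L : Submodule k (Fin n → k)) :
    Subgroup (Matrix.GeneralLinearGroup (Fin n) k) where
  carrier := {g | ∀ x ∈ L, Matrix.mulVec (g : Matrix (Fin n) (Fin n) k) x = x}
  one_mem' := fun x _ => Matrix.one_mulVec x
  mul_mem' := fun {a b} ha hb x hx => by
    rw [Units.val_mul, ← Matrix.mulVec_mulVec, hb x hx, ha x hx]
  inv_mem' := fun {a} ha x hx => by
    have h1 : Matrix.mulVec (↑(a⁻¹) : Matrix (Fin n) (Fin n) k)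
        (Matrix.mulVec (↑a : Matrix (Fin n) (Fin n) k) x) = x := by
      rw [Matrix.mulVec_mulVec, ← Units.val_mul, inv_mul_cancel, Units.val_one,
        Matrix.one_mulVec]
    rw [ha x hx] at h1
    exact h1

/-- The set of reflecting hyperplanes of a subgroup `W` of `GL_n(k)`. -/
def reflHyps {n : ℕ} (W : Subgroup (Matrix.GeneralLinearGroup (Fin n) k)) :
    Set (Submodule k (Fin n → k)) :=
  {H | ∃ g ∈ W, IsReflection ((g : Matrix (Fin n) (Fin n) k)) ∧
      H = LinearMap.ker (Matrix.toLin' ((g : Matrix (Fin n) (Fin n) k)) - LinearMap.id)}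

/-- The set `A'(Wt)` of reflecting hyperplanes `H` of `Wt` such that `Wt_H ≠ G_H`. -/
def reflHyps' {n : ℕ} (Wt G : Subgroup (Matrix.GeneralLinearGroup (Fin n) k)) :
    Set (Submodule k (Fin n → k)) :=
  {H | H ∈ reflHyps Wt ∧ ¬ (Wt ⊓ pointStab H ≤ G)}

/-- `Wt_H` and `Wt_{H'}` have the same image in `W = Wt/G`. -/
def imageEq {n : ℕ} (Wt G : Subgroup (Matrix.GeneralLinearGroup (Fin n) k))
    (H H' : Submodule k (Fin n → k)) : Prop :=
  {x | ∃ g ∈ G, ∃ u ∈ Wt ⊓ pointStab H, x = g * u}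
    = {x | ∃ g ∈ G, ∃ u ∈ Wt ⊓ pointStab H', x = g * u}

/-- `e_H = |G_H|`. -/
def eH {n : ℕ} (G : Subgroup (Matrix.GeneralLinearGroup (Fin n) k))
    (H : Submodule k (Fin n → k)) : ℕ :=
  Nat.card ↥(G ⊓ pointStab H)

/-- The map `p : Vt → V`, `x ↦ (p 1 (x), …, p m (x))`. -/
def pMap {n m : ℕ} (p : Fin m → MvPolynomial (Fin n) k) (x : Fin n → k) : Fin m → k :=
  fun i => eval x (p i)

/-- The matrix of the action of (the image in `W` of) `w` on `V = k^m`. -/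
def qMat {n m : ℕ} {Wt : Subgroup (Matrix.GeneralLinearGroup (Fin n) k)}
    (c : ↥Wt → Fin m → Fin m → k) (w : ↥Wt) : Matrix (Fin m) (Fin m) k :=
  Matrix.of (c w⁻¹)

/-- The set of reflecting hyperplanes of `W = Wt/G` acting on `V = k^m`. -/
def reflHypsV {n m : ℕ} {Wt : Subgroup (Matrix.GeneralLinearGroup (Fin n) k)}
    (c : ↥Wt → Fin m → Fin m → k) : Set (Submodule k (Fin m → k)) :=
  {K | ∃ w : ↥Wt, IsReflection (qMat c w) ∧
      K = LinearMap.ker (Matrix.toLin' (qMat c w) - LinearMap.id)}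

/-- The underlying matrix of an element of a subgroup of `GL_n(k)`. -/
def matOf {n : ℕ} {Wt : Subgroup (Matrix.GeneralLinearGroup (Fin n) k)} (w : ↥Wt) :
    Matrix (Fin n) (Fin n) k :=
  ((w : Matrix.GeneralLinearGroup (Fin n) k) : Matrix (Fin n) (Fin n) k)

open Matrix in
/-- The matrix acting by `z` on the line of `α` and trivially on the kernel of `ℓ`,
where `ℓ ⬝ᵥ α = 1`. -/
def dilation {n : ℕ} (α ℓ : Fin n → k) (z : k) : Matrix (Fin n) (Fin n) k :=
  1 + (z - 1) • vecMulVec α ℓ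

section Dilation

open Matrix

variable {n : ℕ} {α ℓ : Fin n → k}

lemma dilation_mulVec (z : k) (x : Fin n → k) :
    dilation α ℓ z *ᵥ x = x + ((z - 1) * (ℓ ⬝ᵥ x)) • α := by
  rw [dilation, add_mulVec, one_mulVec, smul_mulVec, vecMulVec_mulVec]
  ext i
  simp
  ring

lemma dilation_one : dilation α ℓ 1 = 1 := by simp [dilation]

lemma dilation_mul (h : ℓ ⬝ᵥ α = 1) (a b : k) :
    dilation α ℓ a * dilation α ℓ b = dilation α ℓ (a * b) := by
  simp only [dilation, add_mul, mul_add, one_mul, mul_one, smul_mul_assoc, mul_smul_comm,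
    vecMulVec_mul_vecMulVec, h, one_smul]
  module

lemma dilation_pow (h : ℓ ⬝ᵥ α = 1) (a : k) (j : ℕ) :
    dilation α ℓ a ^ j = dilation α ℓ (a ^ j) := by
  induction j with
  | zero => simp [dilation_one]
  | succ j ih => rw [pow_succ, ih, dilation_mul h, pow_succ]

lemma dilation_eq_one (h : ℓ ⬝ᵥ α = 1) {a : k} : dilation α ℓ a = 1 ↔ a = 1 := by
  refine ⟨fun H => ?_, fun H => H ▸ dilation_one⟩
  have h1 := dilation_mulVec (α := α) (ℓ := ℓ) a α
  rw [H, one_mulVec, h, mul_one] at h1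
  have h2 := congrArg (ℓ ⬝ᵥ ·) h1
  simp only [dotProduct_add, dotProduct_smul, h, smul_eq_mul] at h2
  linear_combination -h2

lemma orderOf_dilation (h : ℓ ⬝ᵥ α = 1) (a : k) : orderOf (dilation α ℓ a) = orderOf a :=
  orderOf_eq_orderOf_iff.2 fun j => by rw [dilation_pow h, dilation_eq_one h]

lemma det_dilation (h : ℓ ⬝ᵥ α = 1) (a : k) : (dilation α ℓ a).det = a := by
  have : dilation α ℓ a
      = 1 + replicateCol Unit ((a - 1) • α) * replicateRow Unit ℓ := by
    rw [dilation, ← vecMulVec_eq, smul_vecMulVec]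
  rw [this, det_one_add_replicateCol_mul_replicateRow, dotProduct_smul, h]
  simp

lemma mem_ker_dilation (h : ℓ ⬝ᵥ α = 1) {a : k} (ha : a ≠ 1) (x : Fin n → k) :
    x ∈ LinearMap.ker (toLin' (dilation α ℓ a) - LinearMap.id) ↔ ℓ ⬝ᵥ x = 0 := by
  have hα : α ≠ 0 := by rintro rfl; simp at h
  rw [LinearMap.mem_ker, LinearMap.sub_apply, toLin'_apply, dilation_mulVec]
  simp [hα, sub_eq_zero, ha]

lemma isReflection_dilation (h : ℓ ⬝ᵥ α = 1) {a : k} (ha : a ≠ 1) (hfin : IsOfFinOrder a) :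
    IsReflection (dilation α ℓ a) := by
  refine ⟨?_, ?_⟩
  · rw [← orderOf_pos_iff, orderOf_dilation h, orderOf_pos_iff]
    exact hfin
  · let φ : (Fin n → k) →ₗ[k] k := dotProductBilin k k ℓ
    have hφ : ∀ x, φ x = ℓ ⬝ᵥ x := fun x => rfl
    have hker : LinearMap.ker (toLin' (dilation α ℓ a) - LinearMap.id) = LinearMap.ker φ := by
      ext x
      rw [mem_ker_dilation h ha, LinearMap.mem_ker, hφ]
    have hr : LinearMap.range φ = ⊤ := LinearMap.range_eq_top.2
      fun c => ⟨c • α, by rw [hφ, dotProduct_smul, h, smul_eq_mul, mul_one]⟩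
    have := LinearMap.finrank_range_add_finrank_ker φ
    rw [hr, finrank_top, Module.finrank_self, Module.finrank_fin_fun] at this
    rw [hker]
    omega

lemma vecMulVec_of_range_le {M : Matrix (Fin n) (Fin n) k} {w : Fin n → k}
    (h : ∀ y, ∃ b : k, M *ᵥ y = b • w) : ∃ φ : Fin n → k, M = vecMulVec w φ := by
  choose b hb using h
  refine ⟨fun j => b (Pi.single j 1), ?_⟩
  ext i j
  have := congrFun (hb (Pi.single j 1)) i
  rw [mulVec_single_one] at this
  simpa [vecMulVec, mul_comm] using this

lemma exists_dilation_of_sub_one {M : Matrix (Fin n) (Fin n) k} {w φ : Fin n → k}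
    (hM : M = 1 + vecMulVec w φ) (h0 : φ ⬝ᵥ w ≠ 0) :
    ∃ ψ : Fin n → k, ψ ⬝ᵥ w = 1 ∧ M = dilation w ψ (1 + φ ⬝ᵥ w) := by
  refine ⟨(φ ⬝ᵥ w)⁻¹ • φ, by simp [h0], ?_⟩
  rw [hM, dilation, vecMulVec_smul, add_sub_cancel_left, smul_smul, mul_inv_cancel₀ h0, one_smul]

lemma exists_one_add_nsmul_pow {R : Type*} [Ring R] (M : R) (j : ℕ) :
    ∃ h : R, M ^ j = 1 + j • (M - 1) + (M - 1) ^ 2 * h := by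
  induction j with
  | zero => exact ⟨0, by simp⟩
  | succ j ih =>
    obtain ⟨h, hh⟩ := ih
    refine ⟨M * h + j • 1, ?_⟩
    rw [pow_succ', hh]
    simp only [nsmul_eq_mul, mul_one, Nat.cast_add, Nat.cast_one]
    have h1 : M * (j : R) = j * M := (Nat.cast_commute j M).eq.symm
    have h2 : M * (j * (M - 1)) = j * (M * (M - 1)) := by rw [← mul_assoc, h1, mul_assoc]
    have h3 : (M - 1) ^ 2 * (j : R) = j * (M - 1) ^ 2 := (Nat.cast_commute j _).eq.symm
    rw [mul_add, mul_add, h2, mul_add ((M - 1) ^ 2), h3]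
    noncomm_ring

lemma exists_dilation_of_isReflection [CharZero k] {M : Matrix (Fin n) (Fin n) k}
    (hM : IsReflection M) :
    ∃ (α ℓ : Fin n → k) (z : k), ℓ ⬝ᵥ α = 1 ∧ z ≠ 1 ∧ M = dilation α ℓ z := by
  obtain ⟨hfin, hker⟩ := hM
  have hrk := LinearMap.finrank_range_add_finrank_ker (toLin' M - LinearMap.id)
  rw [Module.finrank_fin_fun] at hrk
  have hr1 : Module.finrank k (LinearMap.range (toLin' M - LinearMap.id)) = 1 := by omega
  obtain ⟨⟨w, hw⟩, hw0, hspan⟩ := finrank_eq_one_iff'.1 hr1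
  have happ : ∀ y, (toLin' M - LinearMap.id : (Fin n → k) →ₗ[k] (Fin n → k)) y
      = (M - 1) *ᵥ y := fun y => by simp [sub_mulVec]
  obtain ⟨φ, hφ⟩ : ∃ φ, M - 1 = vecMulVec w φ := by
    refine vecMulVec_of_range_le fun y => ?_
    obtain ⟨b, hb⟩ := hspan ⟨_, LinearMap.mem_range_self _ y⟩
    exact ⟨b, by rw [← happ]; exact (congrArg Subtype.val hb).symm⟩
  have hne : φ ⬝ᵥ w ≠ 0 := by
    intro h0
    obtain ⟨j, hj, hj1⟩ := isOfFinOrder_iff_pow_eq_one.1 hfin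
    obtain ⟨h, hh⟩ := exists_one_add_nsmul_pow M j
    have hsq : (M - 1) ^ 2 = 0 := by
      rw [hφ, pow_two, vecMulVec_mul_vecMulVec, h0, zero_smul, vecMulVec_zero]
    rw [hj1, hsq, zero_mul, add_zero, left_eq_add,
      ← Nat.cast_smul_eq_nsmul k, smul_eq_zero, Nat.cast_eq_zero] at hh
    rcases hh with hh | hh
    · omega
    · obtain ⟨y, hy⟩ := hw
      rw [happ, hh, zero_mulVec] at hy
      exact hw0 (Subtype.ext hy.symm)
  obtain ⟨ψ, h1, h2⟩ := exists_dilation_of_sub_one (eq_add_of_sub_eq' hφ) hne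
  exact ⟨w, ψ, _, h1, by simpa using hne, h2⟩

end Dilation

section PolyAct

open Matrix

variable {n m : ℕ}

lemma polyAct_X (N : Matrix (Fin n) (Fin n) k) (i : Fin n) :
    polyAct N (X i) = ∑ j, N i j • X j := aeval_X _ _

lemma eval_polyAct (N : Matrix (Fin n) (Fin n) k) (x : Fin n → k)
    (f : MvPolynomial (Fin n) k) : eval x (polyAct N f) = eval (N *ᵥ x) f := by
  induction f using MvPolynomial.induction_on with
  | C a => simp [polyAct]
  | add f g hf hg => simp [hf, hg]
  | mul_X f i h =>
    rw [map_mul, map_mul, h, map_mul, polyAct_X]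
    simp [mulVec, dotProduct, smul_eval]

lemma polyAct_polyAct (N N' : Matrix (Fin n) (Fin n) k) (f : MvPolynomial (Fin n) k) :
    polyAct N (polyAct N' f) = polyAct (N' * N) f := by
  have : (polyAct N).comp (polyAct N') = polyAct (N' * N) := algHom_ext fun i => by
    rw [AlgHom.comp_apply, polyAct_X, polyAct_X, map_sum]
    simp_rw [map_smul, polyAct_X, Finset.smul_sum, smul_smul, mul_apply, Finset.sum_smul]
    exact Finset.sum_comm
  exact DFunLike.congr_fun this f

lemma polyAct_one : polyAct (1 : Matrix (Fin n) (Fin n) k) = AlgHom.id k _ :=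
  algHom_ext fun i => by rw [polyAct_X]; simp [one_apply]

lemma polyAct_pow (N : Matrix (Fin n) (Fin n) k) (j : ℕ) (f : MvPolynomial (Fin n) k) :
    polyAct (N ^ j) f = (polyAct N)^[j] f := by
  induction j generalizing f with
  | zero => simp [polyAct_one]
  | succ j ih => rw [pow_succ', ← polyAct_polyAct, ih, Function.iterate_succ_apply]

lemma matAct_eq_polyAct (g : GeneralLinearGroup (Fin n) k) :
    matAct g = polyAct (↑g⁻¹ : Matrix (Fin n) (Fin n) k) := rfl

lemma matAct_mul (g h : GeneralLinearGroup (Fin n) k) (f : MvPolynomial (Fin n) k) :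
    matAct (g * h) f = matAct g (matAct h f) := by
  rw [matAct_eq_polyAct, matAct_eq_polyAct, matAct_eq_polyAct, polyAct_polyAct, _root_.mul_inv_rev,
    Units.val_mul]

lemma aeval_polyAct {p : Fin m → MvPolynomial (Fin n) k} {S : Matrix (Fin n) (Fin n) k}
    {M : Matrix (Fin m) (Fin m) k} (h : ∀ i, polyAct S (p i) = ∑ j, M i j • p j)
    (F : MvPolynomial (Fin m) k) : aeval p (polyAct M F) = polyAct S (aeval p F) := by
  have : (aeval p).comp (polyAct M) = (polyAct S).comp (aeval p) := algHom_ext fun i => by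
    rw [AlgHom.comp_apply, AlgHom.comp_apply, polyAct_X, aeval_X, h, map_sum]
    simp
  exact DFunLike.congr_fun this F

lemma eval_aeval (p : Fin m → MvPolynomial (Fin n) k) (v : Fin n → k)
    (F : MvPolynomial (Fin m) k) : eval v (aeval p F) = eval (pMap p v) F := by
  induction F using MvPolynomial.induction_on with
  | C a => simp
  | add f g hf hg => rw [map_add, map_add, map_add, hf, hg]
  | mul_X f i h => rw [map_mul, map_mul, map_mul, h, aeval_X, eval_X, pMap]

/-- The sum of the translates of a polynomial under a finite group. -/
def orbitSum (G : Subgroup (GeneralLinearGroup (Fin n) k)) [Fintype G] :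
    MvPolynomial (Fin n) k →ₗ[k] MvPolynomial (Fin n) k :=
  ∑ g : G, (matAct (g : GeneralLinearGroup (Fin n) k)).toLinearMap

variable (G : Subgroup (GeneralLinearGroup (Fin n) k)) [Fintype G]

lemma orbitSum_apply (f : MvPolynomial (Fin n) k) :
    orbitSum G f = ∑ g : G, matAct (g : GeneralLinearGroup (Fin n) k) f := by
  simp [orbitSum]

lemma orbitSum_mem (f : MvPolynomial (Fin n) k) : orbitSum G f ∈ invariants G := by
  intro g hg
  rw [orbitSum_apply, map_sum]
  simp_rw [← matAct_mul]
  exact Equiv.sum_comp (Equiv.mulLeft (⟨g, hg⟩ : G))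
    fun h : G => matAct (h : GeneralLinearGroup (Fin n) k) f

lemma orbitSum_mul {f : MvPolynomial (Fin n) k} (hf : f ∈ invariants G)
    (b : MvPolynomial (Fin n) k) : orbitSum G (b * f) = orbitSum G b * f := by
  rw [orbitSum_apply, orbitSum_apply, Finset.sum_mul]
  exact Finset.sum_congr rfl fun g _ => by rw [map_mul, hf g g.2]

lemma orbitSum_of_mem {f : MvPolynomial (Fin n) k} (hf : f ∈ invariants G) :
    orbitSum G f = (Nat.card G : k) • f := by
  rw [orbitSum_apply, Finset.sum_congr rfl fun (g : G) _ => hf g.1 g.2, Finset.sum_const,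
    Finset.card_univ, Nat.card_eq_fintype_card, Nat.cast_smul_eq_nsmul]

end PolyAct

section LocalCoordinates

open Matrix

variable {n : ℕ} (α ℓ v : Fin n → k)

/-- The linear form `x ↦ ℓ ⬝ᵥ x` as a polynomial. -/
def linForm : MvPolynomial (Fin n) k := ∑ i, C (ℓ i) * X i

/-- The coordinates, centred at `v`, of the projection along `α` to the kernel of `ℓ`. -/
def projCoord (i : Fin n) : MvPolynomial (Fin n) k := X i - C (v i) - C (α i) * linForm ℓ

/-- The ideal generated by the coordinates of the projection and the `e`-th power of `ℓ`. -/
def locIdeal (e : ℕ) : Ideal (MvPolynomial (Fin n) k) :=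
  Ideal.span (Set.range (projCoord α ℓ v)) ⊔ Ideal.span {linForm ℓ ^ e}

/-- Restriction of polynomial functions to the line through `v` in direction `α`. -/
def lineRestr : MvPolynomial (Fin n) k →ₐ[k] Polynomial k :=
  aeval fun i => Polynomial.C (v i) + Polynomial.C (α i) * Polynomial.X

variable {α ℓ v}

lemma eval_linForm (x : Fin n → k) : eval x (linForm ℓ) = ℓ ⬝ᵥ x := by
  simp [linForm, dotProduct]

lemma eval_projCoord (x : Fin n → k) (i : Fin n) :
    eval x (projCoord α ℓ v i) = x i - v i - α i * ℓ ⬝ᵥ x := by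
  simp [projCoord, eval_linForm]

lemma projCoord_mem (e : ℕ) (i : Fin n) : projCoord α ℓ v i ∈ locIdeal α ℓ v e :=
  Ideal.mem_sup_left (Ideal.subset_span ⟨i, rfl⟩)

lemma linForm_pow_mem (e : ℕ) : linForm ℓ ^ e ∈ locIdeal α ℓ v e :=
  Ideal.mem_sup_right (Ideal.mem_span_singleton_self _)

lemma locIdeal_le {e : ℕ} {J : Ideal (MvPolynomial (Fin n) k)}
    (h1 : ∀ i, projCoord α ℓ v i ∈ J) (h2 : linForm ℓ ^ e ∈ J) : locIdeal α ℓ v e ≤ J := by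
  refine sup_le (Ideal.span_le.2 ?_) (Ideal.span_le.2 ?_)
  · rintro _ ⟨i, rfl⟩
    exact h1 i
  · rintro _ rfl
    exact h2

section

variable [CharZero k] (h : ℓ ⬝ᵥ α = 1)
include h

lemma polyAct_linForm (z : k) : polyAct (dilation α ℓ z) (linForm ℓ) = C z * linForm ℓ := by
  refine MvPolynomial.funext fun x => ?_
  rw [eval_polyAct, eval_linForm, dilation_mulVec, dotProduct_add, dotProduct_smul, h, map_mul,
    eval_linForm, eval_C]
  simp
  ring

lemma polyAct_projCoord (z : k) (i : Fin n) :
    polyAct (dilation α ℓ z) (projCoord α ℓ v i) = projCoord α ℓ v i := by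
  refine MvPolynomial.funext fun x => ?_
  rw [eval_polyAct, eval_projCoord, dilation_mulVec, dotProduct_add, dotProduct_smul, h,
    eval_projCoord]
  simp
  ring

lemma polyAct_mem_locIdeal (z : k) (e : ℕ) :
    (locIdeal α ℓ v e).map (polyAct (dilation α ℓ z)) ≤ locIdeal α ℓ v e := by
  rw [Ideal.map_le_iff_le_comap]
  refine locIdeal_le (fun i => ?_) ?_
  · rw [Ideal.mem_comap, polyAct_projCoord h]
    exact projCoord_mem e i
  · rw [Ideal.mem_comap, map_pow, polyAct_linForm h, mul_pow]
    exact Ideal.mul_mem_left _ _ (linForm_pow_mem e)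

end

lemma lineRestr_linForm (h : ℓ ⬝ᵥ α = 1) (hv : ℓ ⬝ᵥ v = 0) :
    lineRestr α v (linForm ℓ) = Polynomial.X := by
  have : lineRestr α v (linForm ℓ)
      = Polynomial.C (ℓ ⬝ᵥ v) + Polynomial.C (ℓ ⬝ᵥ α) * Polynomial.X := by
    simp only [lineRestr, linForm, dotProduct, map_sum, map_mul, aeval_X, mul_add,
      Finset.sum_add_distrib, Finset.sum_mul, ← mul_assoc, algHom_C, Polynomial.C_eq_algebraMap]
  rw [this, h, hv]
  simp

lemma lineRestr_projCoord (h : ℓ ⬝ᵥ α = 1) (hv : ℓ ⬝ᵥ v = 0) (i : Fin n) :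
    lineRestr α v (projCoord α ℓ v i) = 0 := by
  rw [projCoord, map_sub, map_sub, map_mul, lineRestr_linForm h hv]
  simp [lineRestr, Polynomial.C_eq_algebraMap]

lemma sub_C_eval_mem_locIdeal (f : MvPolynomial (Fin n) k) :
    f - C (eval v f) ∈ locIdeal α ℓ v 1 := by
  have hX : ∀ i, X i - C (v i) ∈ locIdeal α ℓ v 1 := fun i => by
    have := add_mem (projCoord_mem (α := α) (ℓ := ℓ) (v := v) 1 i)
      (Ideal.mul_mem_left _ (C (α i)) (linForm_pow_mem (α := α) (ℓ := ℓ) (v := v) 1))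
    rwa [projCoord, pow_one, sub_add_cancel] at this
  induction f using MvPolynomial.induction_on with
  | C a => simp
  | add f g hf hg =>
    have := add_mem hf hg
    rwa [show f - C (eval v f) + (g - C (eval v g)) = f + g - C (eval v (f + g)) by
      rw [map_add, map_add]; ring] at this
  | mul_X f i hf =>
    have := add_mem (Ideal.mul_mem_left _ (X i) hf)
      (Ideal.mul_mem_left _ (C (eval v f)) (hX i))
    rwa [show X i * (f - C (eval v f)) + C (eval v f) * (X i - C (v i))
      = f * X i - C (eval v (f * X i)) by rw [map_mul, eval_X, map_mul]; ring] at this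

lemma locIdeal_one_pow_le (e : ℕ) : locIdeal α ℓ v 1 ^ e ≤ locIdeal α ℓ v e := by
  induction e with
  | zero =>
    rw [Ideal.eq_top_of_isUnit_mem (locIdeal α ℓ v 0) (linForm_pow_mem 0) (by simp)]
    exact le_top
  | succ e ih =>
    rw [pow_succ]
    refine (Ideal.mul_mono_left ih).trans (Ideal.mul_le.2 fun a ha b hb => ?_)
    obtain ⟨a₁, ha₁, a₂, ha₂, rfl⟩ := Submodule.mem_sup.1 ha
    obtain ⟨b₁, hb₁, b₂, hb₂, rfl⟩ := Submodule.mem_sup.1 hb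
    obtain ⟨a₃, rfl⟩ := Ideal.mem_span_singleton.1 ha₂
    obtain ⟨b₃, rfl⟩ := Ideal.mem_span_singleton.1 hb₂
    rw [show (a₁ + linForm ℓ ^ e * a₃) * (b₁ + linForm ℓ ^ 1 * b₃)
      = (b₁ + linForm ℓ ^ 1 * b₃) * a₁ + linForm ℓ ^ e * a₃ * b₁
        + a₃ * b₃ * linForm ℓ ^ (e + 1) by ring]
    exact add_mem (Ideal.mem_sup_left (add_mem (Ideal.mul_mem_left _ _ ha₁)
      (Ideal.mul_mem_left _ _ hb₁))) (Ideal.mul_mem_left _ _ (linForm_pow_mem _))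

lemma ker_eval_le : RingHom.ker (eval v) ≤ locIdeal α ℓ v 1 := fun f hf => by
  have := sub_C_eval_mem_locIdeal (α := α) (ℓ := ℓ) (v := v) f
  rwa [RingHom.mem_ker.1 hf, map_zero, sub_zero] at this

lemma ker_eval_pow_le (e : ℕ) :
    RingHom.ker (eval v) ^ e ≤ locIdeal α ℓ v e :=
  (Ideal.pow_right_mono ker_eval_le e).trans (locIdeal_one_pow_le e)

lemma eq_zero_of_C_mul_linForm_pow_mem (h : ℓ ⬝ᵥ α = 1) (hv : ℓ ⬝ᵥ v = 0)
    {J : Ideal (MvPolynomial (Fin n) k)} {e N : ℕ} (heN : e < N)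
    (hJ : J.map (lineRestr α v) ≤ Ideal.span {Polynomial.X ^ N}) {c : k}
    (hc : C c * linForm ℓ ^ e ∈ J) : c = 0 := by
  have h1 := hJ (Ideal.mem_map_of_mem (lineRestr α v) hc)
  rw [map_mul, map_pow, lineRestr_linForm h hv, Ideal.mem_span_singleton,
    Polynomial.X_pow_dvd_iff] at h1
  have h2 := h1 e heN
  rw [← algebraMap_eq, AlgHom.commutes] at h2
  simpa using h2

lemma map_locIdeal_le (h : ℓ ⬝ᵥ α = 1) (hv : ℓ ⬝ᵥ v = 0) (e : ℕ) :
    (locIdeal α ℓ v e).map (lineRestr α v) ≤ Ideal.span {Polynomial.X ^ e} := by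
  rw [Ideal.map_le_iff_le_comap]
  refine locIdeal_le (fun i => ?_) ?_
  · rw [Ideal.mem_comap, lineRestr_projCoord h hv]
    exact zero_mem _
  · rw [Ideal.mem_comap, map_pow, lineRestr_linForm h hv]
    exact Ideal.mem_span_singleton_self _

lemma map_locIdeal_pow_le (h : ℓ ⬝ᵥ α = 1) (hv : ℓ ⬝ᵥ v = 0) (e j : ℕ) :
    (locIdeal α ℓ v e ^ j).map (lineRestr α v) ≤ Ideal.span {Polynomial.X ^ (e * j)} := by
  rw [Ideal.map_pow, pow_mul, ← Ideal.span_singleton_pow]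
  exact Ideal.pow_right_mono (map_locIdeal_le h hv e) j

end LocalCoordinates

section Expansion

open Matrix

variable {n : ℕ} {α ℓ v : Fin n → k}

lemma sum_pow_eq_zero_of_not_dvd {Γ : Type*} [Group Γ] [Fintype Γ] (χ : Γ →* k)
    (hχ : Function.Injective χ) {j : ℕ} (hj : ¬ Nat.card Γ ∣ j) :
    ∑ g, χ g ^ j = 0 := by
  have hcyc : IsCyclic Γ := isCyclic_of_injective_ringHom χ hχ
  refine sum_hom_units_eq_zero (χ ^ j) fun h => hj ?_
  rw [← IsCyclic.exponent_eq_card]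
  refine Monoid.exponent_dvd_of_forall_pow_eq_one fun g => hχ ?_
  rw [map_pow, map_one, ← MonoidHom.pow_apply, h, MonoidHom.one_apply]

variable [CharZero k] (h : ℓ ⬝ᵥ α = 1)
include h

lemma mem_adjoin_of_mem_invariants (Γ : Subgroup (GeneralLinearGroup (Fin n) k)) [Fintype Γ]
    (χ : Γ →* k) (hχ : Function.Injective χ) (hΓ : ∀ g : Γ, matOf g = dilation α ℓ (χ g))
    {f : MvPolynomial (Fin n) k} (hf : f ∈ invariants Γ) :
    f ∈ Algebra.adjoin k
      (insert (linForm ℓ ^ Nat.card Γ) (Set.range (projCoord α ℓ v))) := by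
  set S := Algebra.adjoin k (insert (linForm ℓ ^ Nat.card Γ) (Set.range (projCoord α ℓ v)))
    with hS
  have hact : ∀ g : Γ, matAct (g : GeneralLinearGroup (Fin n) k)
      = polyAct (dilation α ℓ (χ g⁻¹)) := fun g => by
    rw [matAct_eq_polyAct, ← hΓ]
    rfl
  have hproj : ∀ i, projCoord α ℓ v i ∈ invariants Γ := fun i g hg => by
    rw [hact ⟨g, hg⟩, polyAct_projCoord h]
  have hprojS : ∀ i, projCoord α ℓ v i ∈ S := fun i =>
    Algebra.subset_adjoin (Set.mem_insert_of_mem _ ⟨i, rfl⟩)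
  have hpow : ∀ j, orbitSum Γ (linForm ℓ ^ j) ∈ S := fun j => by
    have hsum : orbitSum Γ (linForm ℓ ^ j) = C (∑ g, χ g ^ j) * linForm ℓ ^ j := by
      rw [orbitSum_apply, ← Equiv.sum_comp (Equiv.inv Γ) fun g => χ g ^ j, map_sum, Finset.sum_mul]
      refine Finset.sum_congr rfl fun g _ => ?_
      rw [hact, map_pow, polyAct_linForm h, mul_pow, map_pow]
      rfl
    rw [hsum]
    by_cases hj : Nat.card Γ ∣ j
    · obtain ⟨i, rfl⟩ := hj
      rw [pow_mul (linForm ℓ)]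
      exact mul_mem (S.algebraMap_mem _)
        (pow_mem (Algebra.subset_adjoin (Set.mem_insert _ _)) i)
    · rw [sum_pow_eq_zero_of_not_dvd χ hχ hj, map_zero, zero_mul]
      exact zero_mem S
  have key : ∀ (b : MvPolynomial (Fin n) k) (j : ℕ), orbitSum Γ (linForm ℓ ^ j * b) ∈ S := by
    intro b
    induction b using MvPolynomial.induction_on with
    | C a =>
      intro j
      rw [mul_comm, ← smul_eq_C_mul, map_smul]
      exact S.smul_mem (hpow j) a
    | add f g hf hg =>
      intro j
      rw [mul_add, map_add]
      exact add_mem (hf j) (hg j)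
    | mul_X b i hb =>
      intro j
      have : linForm ℓ ^ j * (b * X i) = v i • (linForm ℓ ^ j * b)
          + linForm ℓ ^ j * b * projCoord α ℓ v i + α i • (linForm ℓ ^ (j + 1) * b) := by
        rw [smul_eq_C_mul, smul_eq_C_mul, projCoord]
        ring
      rw [this, map_add, map_add, map_smul, map_smul, orbitSum_mul _ (hproj i)]
      exact add_mem (add_mem (S.smul_mem (hb j) _) (mul_mem (hb j) (hprojS i)))
        (S.smul_mem (hb (j + 1)) _)
  have h0 : (Nat.card Γ : k) ≠ 0 := Nat.cast_ne_zero.2 Nat.card_pos.ne'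
  have h1 := S.smul_mem (key f 0) (Nat.card Γ : k)⁻¹
  rwa [pow_zero, one_mul, orbitSum_of_mem Γ hf, smul_smul, inv_mul_cancel₀ h0, one_smul] at h1

lemma exists_expansion (z : k) (e : ℕ) {f : MvPolynomial (Fin n) k}
    (hf : f ∈ Algebra.adjoin k (insert (linForm ℓ ^ e) (Set.range (projCoord α ℓ v)))) :
    ∃ c b : k, f - C c ∈ locIdeal α ℓ v e ∧
      polyAct (dilation α ℓ z) f - f - C b * linForm ℓ ^ e ∈ locIdeal α ℓ v e ^ 2 := by
  induction hf using Algebra.adjoin_induction with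
  | mem x hx =>
    rcases hx with rfl | ⟨i, rfl⟩
    · refine ⟨0, z ^ e - 1, by simpa using linForm_pow_mem e, ?_⟩
      rw [map_pow, polyAct_linForm h, mul_pow, map_sub, map_pow, map_one]
      convert zero_mem (locIdeal α ℓ v e ^ 2) using 1
      ring
    · exact ⟨0, 0, by simpa using projCoord_mem e i, by simp [polyAct_projCoord h]⟩
  | algebraMap r =>
    refine ⟨r, 0, ?_, ?_⟩
    · rw [algebraMap_eq, sub_self]
      exact zero_mem _
    · rw [AlgHom.commutes]
      simp
  | add x y _ _ hx hy =>
    obtain ⟨c₁, b₁, h₁, h₁'⟩ := hx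
    obtain ⟨c₂, b₂, h₂, h₂'⟩ := hy
    refine ⟨c₁ + c₂, b₁ + b₂, ?_, ?_⟩
    · convert add_mem h₁ h₂ using 1
      rw [map_add]
      ring
    · convert add_mem h₁' h₂' using 1
      rw [map_add, map_add]
      ring
  | mul x y _ _ hx hy =>
    obtain ⟨c₁, b₁, h₁, h₁'⟩ := hx
    obtain ⟨c₂, b₂, h₂, h₂'⟩ := hy
    have h₃ : polyAct (dilation α ℓ z) y - C c₂ ∈ locIdeal α ℓ v e := by
      have := polyAct_mem_locIdeal h z e (Ideal.mem_map_of_mem _ h₂)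
      rwa [map_sub, ← algebraMap_eq, AlgHom.commutes, algebraMap_eq] at this
    have ht := linForm_pow_mem (α := α) (ℓ := ℓ) (v := v) e
    refine ⟨c₁ * c₂, b₁ * c₂ + c₁ * b₂, ?_, ?_⟩
    · convert add_mem (Ideal.mul_mem_left _ y h₁) (Ideal.mul_mem_left _ (C c₁) h₂) using 1
      rw [map_mul]
      ring
    · have h₄ := Ideal.mul_mem_left _ (C b₁) (Ideal.mul_mem_mul ht h₃)
      have h₅ := Ideal.mul_mem_left _ (C b₂) (Ideal.mul_mem_mul ht h₁)
      rw [← pow_two] at h₄ h₅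
      convert add_mem (add_mem (Ideal.mul_mem_right (polyAct (dilation α ℓ z) y) _ h₁')
        (Ideal.mul_mem_left _ x h₂')) (add_mem h₄ h₅) using 1
      rw [map_mul, map_add, map_mul, map_mul]
      ring

end Expansion

section Bump

open Matrix

variable {n : ℕ}

lemma exists_eval_eq_one_eval_eq_zero (v : Fin n → k) (s : Finset (Fin n → k)) (hv : v ∉ s) :
    ∃ c : MvPolynomial (Fin n) k, eval v c = 1 ∧ ∀ w ∈ s, eval w c = 0 := by
  classical
  induction s using Finset.induction_on with
  | empty => exact ⟨1, by simp⟩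
  | insert a s _ ih =>
    rw [Finset.mem_insert, not_or] at hv
    obtain ⟨c, hc, hc'⟩ := ih hv.2
    obtain ⟨i, hi⟩ := Function.ne_iff.1 hv.1
    refine ⟨c * (C (v i - a i)⁻¹ * (X i - C (a i))), ?_, fun w hw => ?_⟩
    · simp [hc, sub_ne_zero.2 hi]
    · rcases Finset.mem_insert.1 hw with rfl | hw
      · simp
      · simp [hc' w hw]

variable (G : Subgroup (GeneralLinearGroup (Fin n) k)) [Fintype G]
  {Γ : Subgroup (GeneralLinearGroup (Fin n) k)} {v : Fin n → k}

lemma exists_bump (hv : ∀ g ∈ G, g ∈ Γ ↔ (g : Matrix (Fin n) (Fin n) k) *ᵥ v = v) (N : ℕ) :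
    ∃ c : MvPolynomial (Fin n) k,
    (∀ g ∈ G, g ∈ Γ → matAct g c - 1 ∈ RingHom.ker (eval v) ^ N) ∧
      ∀ g ∈ G, g ∉ Γ → matAct g c ∈ RingHom.ker (eval v) ^ N := by
  classical
  obtain ⟨c, hc, hc'⟩ := exists_eval_eq_one_eval_eq_zero v
    ((Finset.univ.image fun g : G => matOf g *ᵥ v).erase v) (Finset.notMem_erase _ _)
  have hmem : ∀ g ∈ G, g⁻¹ ∈ Γ ↔ g ∈ Γ := fun g _ => inv_mem_iff
  refine ⟨1 - (1 - c ^ N) ^ N, fun g hg hgΓ => ?_, fun g hg hgΓ => ?_⟩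
  · have h1 : eval v (matAct g c) = 1 := by
      rw [matAct_eq_polyAct, eval_polyAct, (hv g⁻¹ (inv_mem hg)).1 (inv_mem hgΓ), hc]
    have h2 : 1 - matAct g c ^ N ∈ RingHom.ker (eval v) := by simp [RingHom.mem_ker, h1]
    convert neg_mem (Ideal.pow_mem_pow h2 N) using 1
    simp
  · have h1 : matAct g c ∈ RingHom.ker (eval v) := by
      rw [RingHom.mem_ker, matAct_eq_polyAct, eval_polyAct]
      refine hc' _ (Finset.mem_erase.2 ⟨fun h => hgΓ ?_, ?_⟩)
      · exact inv_mem_iff.1 ((hv g⁻¹ (inv_mem hg)).2 h)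
      · exact Finset.mem_image.2 ⟨⟨g⁻¹, inv_mem hg⟩, Finset.mem_univ _, rfl⟩
    have h2 : matAct g c ^ N ∣ 1 - (1 - matAct g c ^ N) ^ N := by
      simpa using sub_dvd_pow_sub_pow (1 : MvPolynomial (Fin n) k) (1 - matAct g c ^ N) N
    rw [map_sub, map_one, map_pow, map_sub, map_one, map_pow]
    exact Ideal.mem_of_dvd _ h2 (Ideal.pow_mem_pow h1 N)

lemma orbitSum_bump_sub_mem (hΓ : Γ ≤ G) {N : ℕ} {c b : MvPolynomial (Fin n) k}
    (h1 : ∀ g ∈ G, g ∈ Γ → matAct g c - 1 ∈ RingHom.ker (eval v) ^ N)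
    (h2 : ∀ g ∈ G, g ∉ Γ → matAct g c ∈ RingHom.ker (eval v) ^ N) (hb : b ∈ invariants Γ) :
    orbitSum G (c * b) - C (Nat.card Γ : k) * b ∈ RingHom.ker (eval v) ^ N := by
  classical
  have hcard : C (Nat.card Γ : k) * b
      = ∑ g : G, if (g : GeneralLinearGroup (Fin n) k) ∈ Γ then b else 0 := by
    rw [← Finset.sum_filter, Finset.sum_const, ← Fintype.card_subtype, ← Nat.card_eq_fintype_card,
      ← Nat.cast_smul_eq_nsmul k, smul_eq_C_mul,
      Nat.card_congr (Subgroup.subgroupOfEquivOfLe hΓ).symm.toEquiv]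
    rfl
  rw [hcard, orbitSum_apply, ← Finset.sum_sub_distrib]
  refine sum_mem fun g _ => ?_
  split_ifs with hg
  · convert Ideal.mul_mem_right b _ (h1 g g.2 hg) using 1
    rw [map_mul, hb g hg]
    ring
  · rw [map_mul, sub_zero]
    exact Ideal.mul_mem_right _ _ (h2 g g.2 hg)

end Bump

section LocalGenerators

open Matrix

variable {n m : ℕ}

/-- The ideal generated by the `G`-invariant polynomials vanishing at `v`. -/
def vanishIdeal (G : Subgroup (GeneralLinearGroup (Fin n) k)) (v : Fin n → k) :
    Ideal (MvPolynomial (Fin n) k) :=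
  Ideal.span {f | f ∈ invariants G ∧ eval v f = 0}

lemma exists_aeval_eq {p : Fin m → MvPolynomial (Fin n) k}
    {G : Subgroup (GeneralLinearGroup (Fin n) k)}
    (hgen : Algebra.adjoin k (Set.range p) = invariants G)
    {f : MvPolynomial (Fin n) k} (hf : f ∈ invariants G) :
    ∃ F : MvPolynomial (Fin m) k, aeval p F = f := by
  rwa [← hgen, Algebra.adjoin_range_eq_range_aeval] at hf

lemma aeval_mem_invariants {p : Fin m → MvPolynomial (Fin n) k}
    {G : Subgroup (GeneralLinearGroup (Fin n) k)}
    (hgen : Algebra.adjoin k (Set.range p) = invariants G)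
    (F : MvPolynomial (Fin m) k) : aeval p F ∈ invariants G := by
  rw [← hgen, Algebra.adjoin_range_eq_range_aeval]
  exact ⟨F, rfl⟩

variable [CharZero k] (G : Subgroup (GeneralLinearGroup (Fin n) k)) [Fintype G]
  {Γ : Subgroup (GeneralLinearGroup (Fin n) k)} {α ℓ v : Fin n → k}
  (hv : ∀ g ∈ G, g ∈ Γ ↔ (g : Matrix (Fin n) (Fin n) k) *ᵥ v = v) (hΓ : Γ ≤ G)
  (hℓv : ℓ ⬝ᵥ v = 0) {e : ℕ} (he : e ≠ 0)
  (hproj : ∀ i, projCoord α ℓ v i ∈ invariants Γ) (hpow : linForm ℓ ^ e ∈ invariants Γ)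

include hv hΓ in
lemma mem_vanishIdeal_sup {N : ℕ} {b : MvPolynomial (Fin n) k} (hb : b ∈ invariants Γ)
    (hbv : eval v b = 0) : b ∈ vanishIdeal G v ⊔ RingHom.ker (eval v) ^ (N + 1) := by
  obtain ⟨c, h1, h2⟩ := exists_bump G hv (N + 1)
  have hmem := orbitSum_bump_sub_mem G hΓ h1 h2 hb
  have hev : eval v (orbitSum G (c * b)) = 0 := by
    have := Ideal.pow_le_self N.succ_ne_zero hmem
    rwa [RingHom.mem_ker, map_sub, map_mul (eval v), hbv, mul_zero, sub_zero] at this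
  have hcard : (Nat.card Γ : k) ≠ 0 := by
    have : Finite Γ := Finite.of_injective _ (Subgroup.inclusion_injective hΓ)
    exact Nat.cast_ne_zero.2 Nat.card_pos.ne'
  have h3 : orbitSum G (c * b) ∈ vanishIdeal G v := Ideal.subset_span ⟨orbitSum_mem G _, hev⟩
  have h4 := Ideal.mul_mem_left _ (C (Nat.card Γ : k)⁻¹)
    (sub_mem (Ideal.mem_sup_left h3) (Ideal.mem_sup_right (S := vanishIdeal G v) hmem))
  rwa [sub_sub_cancel, ← mul_assoc, ← C_mul, inv_mul_cancel₀ hcard, C_1, one_mul] at h4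

include hv hΓ hℓv he hproj hpow in
lemma exists_mul_mem_vanishIdeal : ∃ θ : MvPolynomial (Fin n) k, eval v θ = 1 ∧
    ∀ q ∈ locIdeal α ℓ v e, θ * q ∈ vanishIdeal G v := by
  have hle : RingHom.ker (eval v) ^ (e + 1)
      ≤ RingHom.ker (eval v) • locIdeal α ℓ v e := by
    rw [pow_succ', smul_eq_mul]
    exact Ideal.mul_mono_right (ker_eval_pow_le e)
  have hQ : locIdeal α ℓ v e
      ≤ vanishIdeal G v ⊔ RingHom.ker (eval v) • locIdeal α ℓ v e := by
    refine locIdeal_le (fun i => ?_) ?_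
    · exact sup_le_sup_left hle _ (mem_vanishIdeal_sup G hv hΓ (hproj i)
        (by simp [eval_projCoord, hℓv]))
    · exact sup_le_sup_left hle _ (mem_vanishIdeal_sup G hv hΓ hpow
        (by simp [eval_linForm, hℓv, he]))
  obtain ⟨θ, hθ, hθ'⟩ := Submodule.exists_sub_one_mem_and_smul_le_of_fg_of_le_sup
    (IsNoetherian.noetherian (locIdeal α ℓ v e)) le_rfl hQ
  refine ⟨θ, ?_, fun q hq => hθ' (Submodule.smul_mem_pointwise_smul q θ _ hq)⟩
  rw [RingHom.mem_ker, map_sub, map_one] at hθ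
  exact sub_eq_zero.1 hθ

variable {p : Fin m → MvPolynomial (Fin n) k}
  (φ : MvPolynomial (Fin m) k →ₐ[k] DualNumber k)

omit [CharZero k] in
lemma exists_lift_orbitSum (hgen : Algebra.adjoin k (Set.range p) = invariants G)
    (hφ : ∀ F, (φ F).fst = eval v (aeval p F)) {b : MvPolynomial (Fin n) k}
    (hb : b ∈ vanishIdeal G v ^ 2) : ∃ F, φ F = 0 ∧ aeval p F = orbitSum G b := by
  rw [pow_two, vanishIdeal, Ideal.span_mul_span'] at hb
  suffices H : ∀ a, ∃ F, φ F = 0 ∧ aeval p F = orbitSum G (a * b) by simpa using H 1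
  induction hb using Submodule.span_induction with
  | mem x hx =>
    obtain ⟨f₁, ⟨hf₁, hf₁v⟩, f₂, ⟨hf₂, hf₂v⟩, rfl⟩ := Set.mem_mul.1 hx
    intro a
    obtain ⟨A, hA⟩ := exists_aeval_eq hgen (orbitSum_mem G a)
    obtain ⟨F₁, rfl⟩ := exists_aeval_eq hgen hf₁
    obtain ⟨F₂, rfl⟩ := exists_aeval_eq hgen hf₂
    refine ⟨A * (F₁ * F₂), ?_, ?_⟩
    · rw [← hφ] at hf₁v hf₂v
      rw [map_mul, map_mul, show φ F₁ * φ F₂ = 0 by ext <;> simp [hf₁v, hf₂v], mul_zero]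
    · rw [orbitSum_mul G (mul_mem hf₁ hf₂), map_mul, map_mul, hA]
  | zero => exact fun a => ⟨0, by simp⟩
  | add x y _ _ hx hy =>
    intro a
    obtain ⟨F₁, h₁, h₁'⟩ := hx a
    obtain ⟨F₂, h₂, h₂'⟩ := hy a
    exact ⟨F₁ + F₂, by simp [h₁, h₂], by rw [map_add, h₁', h₂', mul_add, map_add]⟩
  | smul r x _ hx =>
    intro a
    obtain ⟨F, h, h'⟩ := hx (a * r)
    exact ⟨F, h, by rw [h', smul_eq_mul, mul_assoc]⟩

include hv hΓ hℓv he hproj hpow in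
/-- A tangent vector of the quotient by `G` at the image of `v`, viewed as a homomorphism to the
dual numbers, kills every invariant polynomial in the square of the local ideal at `v`. -/
lemma eq_zero_of_aeval_mem_sq (hgen : Algebra.adjoin k (Set.range p) = invariants G)
    (hφ : ∀ F, (φ F).fst = eval v (aeval p F)) (hφ' : ∀ F, aeval p F = 0 → φ F = 0)
    {F : MvPolynomial (Fin m) k} (hF : aeval p F ∈ locIdeal α ℓ v e ^ 2) : φ F = 0 := by
  classical
  obtain ⟨θ, hθ, hθ'⟩ := exists_mul_mem_vanishIdeal G hv hΓ hℓv he hproj hpow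
  obtain ⟨c, h1, h2⟩ := exists_bump G hv 1
  have hmem : c * θ ^ 2 * aeval p F ∈ vanishIdeal G v ^ 2 := by
    have hle : Ideal.span {θ} * locIdeal α ℓ v e ≤ vanishIdeal G v :=
      Ideal.span_singleton_mul_le_iff.2 hθ'
    have := Ideal.mul_mem_left _ c (Ideal.pow_right_mono hle 2 (by
      rw [mul_pow]
      exact Ideal.mul_mem_mul (Ideal.pow_mem_pow (Ideal.mem_span_singleton_self θ) 2) hF))
    rwa [← mul_assoc] at this
  obtain ⟨F', hF', hF''⟩ := exists_lift_orbitSum G φ hgen hφ hmem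
  obtain ⟨Ψ, hΨ⟩ := exists_aeval_eq hgen (orbitSum_mem G (c * θ ^ 2))
  have hzero : φ (Ψ * F - F') = 0 := hφ' _ (by
    rw [map_sub, map_mul, hΨ, hF'', orbitSum_mul G (aeval_mem_invariants hgen F), sub_self])
  rw [map_sub, hF', sub_zero, map_mul] at hzero
  have hunit : IsUnit (φ Ψ) := by
    rw [TrivSqZeroExt.isUnit_iff_isUnit_fst, isUnit_iff_ne_zero, hφ, hΨ, orbitSum_apply, map_sum]
    have hterm : ∀ g : G, eval v (matAct (g : GeneralLinearGroup (Fin n) k) (c * θ ^ 2))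
        = if (g : GeneralLinearGroup (Fin n) k) ∈ Γ then 1 else 0 := fun g => by
      rw [map_mul, map_mul]
      split_ifs with hg
      · have h3 := h1 g g.2 hg
        rw [pow_one, RingHom.mem_ker, map_sub, map_one, sub_eq_zero] at h3
        rw [h3, matAct_eq_polyAct, eval_polyAct, (hv _ (inv_mem g.2)).1 (inv_mem hg), map_pow, hθ]
        simp
      · have h3 := h2 g g.2 hg
        rw [pow_one, RingHom.mem_ker] at h3
        rw [h3, zero_mul]
    rw [Finset.sum_congr rfl fun g _ => hterm g, Finset.sum_boole, Nat.cast_ne_zero]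
    exact Finset.card_ne_zero_of_mem (a := (1 : G))
      (Finset.mem_filter.2 ⟨Finset.mem_univ _, one_mem Γ⟩)
  exact (hunit.mul_right_eq_zero).1 hzero

end LocalGenerators

section Conormal

open Matrix

variable {m : ℕ}

/-- Evaluation in the dual numbers at the tangent vector `y` based at `x`. -/
def tangentEval (x y : Fin m → k) : MvPolynomial (Fin m) k →ₐ[k] DualNumber k :=
  aeval fun i => TrivSqZeroExt.inl (x i) + TrivSqZeroExt.inr (y i)

lemma tangentEval_X (x y : Fin m → k) (i : Fin m) :
    tangentEval x y (X i) = TrivSqZeroExt.inl (x i) + TrivSqZeroExt.inr (y i) := aeval_X _ _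

lemma fst_tangentEval (x y : Fin m → k) (F : MvPolynomial (Fin m) k) :
    (tangentEval x y F).fst = eval x F := by
  induction F using MvPolynomial.induction_on with
  | C a => rw [← algebraMap_eq, AlgHom.commutes, algebraMap_eq, eval_C]; rfl
  | add f g hf hg => rw [map_add, map_add, TrivSqZeroExt.fst_add, hf, hg]
  | mul_X f i h => rw [map_mul, map_mul, TrivSqZeroExt.fst_mul, h, tangentEval_X]; simp

lemma snd_tangentEval_sub (x y y' : Fin m → k) (F : MvPolynomial (Fin m) k) :
    (tangentEval x (y - y') F).snd = (tangentEval x y F).snd - (tangentEval x y' F).snd := by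
  induction F using MvPolynomial.induction_on with
  | C a => simp only [← algebraMap_eq, AlgHom.commutes, sub_self]; rfl
  | add f g hf hg => simp only [map_add, TrivSqZeroExt.snd_add, hf, hg]; ring
  | mul_X f i h =>
    simp only [map_mul, DualNumber.snd_mul, h, tangentEval_X, fst_tangentEval]
    simp
    ring

lemma tangentEval_polyAct {M : Matrix (Fin m) (Fin m) k} {x : Fin m → k} (hx : M *ᵥ x = x)
    (y : Fin m → k) (F : MvPolynomial (Fin m) k) :
    tangentEval x y (polyAct M F) = tangentEval x (M *ᵥ y) F := by
  have : (tangentEval x y).comp (polyAct M) = tangentEval x (M *ᵥ y) := algHom_ext fun i => by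
    rw [AlgHom.comp_apply, polyAct_X, tangentEval_X, map_sum]
    simp_rw [map_smul, tangentEval_X]
    conv_rhs => rw [← hx]
    ext <;> simp [mulVec, dotProduct, TrivSqZeroExt.fst_sum, TrivSqZeroExt.snd_sum]
  exact DFunLike.congr_fun this F

/-- If a finite order automorphism acts trivially on `I / A₊ I`, then `I` is generated by
fixed elements in a neighbourhood of the origin. -/
lemma exists_mul_mem_span_fixed [CharZero k] {M : Matrix (Fin m) (Fin m) k} {r : ℕ} (hr : r ≠ 0)
    (hM : M ^ r = 1) (I : Ideal (MvPolynomial (Fin m) k))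
    (hI : ∀ f ∈ I, polyAct M f - f ∈ idealPlus k m * I) :
    ∃ a : MvPolynomial (Fin m) k, a - 1 ∈ idealPlus k m ∧
      ∀ f ∈ I, a * f ∈ Ideal.span {f | f ∈ I ∧ polyAct M f = f} := by
  have hstab : ∀ f ∈ I, polyAct M f ∈ I := fun f hf => by
    simpa using add_mem (Ideal.mul_le_right (hI f hf)) hf
  have hiter : ∀ j, ∀ f ∈ I, (polyAct M)^[j] f ∈ I ∧ (polyAct M)^[j] f - f ∈ idealPlus k m * I := by
    intro j
    induction j with
    | zero => exact fun f hf => ⟨hf, by simp⟩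
    | succ j ih =>
      intro f hf
      rw [Function.iterate_succ_apply']
      obtain ⟨h1, h2⟩ := ih f hf
      refine ⟨hstab _ h1, ?_⟩
      have := add_mem (hI _ h1) h2
      rwa [sub_add_sub_cancel] at this
  have hle : I ≤ Ideal.span {f | f ∈ I ∧ polyAct M f = f} ⊔ idealPlus k m • I := by
    intro f hf
    have hfix : polyAct M (∑ j ∈ Finset.range r, (polyAct M)^[j] f)
        = ∑ j ∈ Finset.range r, (polyAct M)^[j] f := by
      rw [map_sum]
      simp_rw [← Function.iterate_succ_apply']
      have h1 := Finset.sum_range_succ (fun j => (polyAct M)^[j] f) r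
      rw [Finset.sum_range_succ', ← polyAct_pow M r, hM, polyAct_one] at h1
      exact add_right_cancel h1
    have h1 : ∑ j ∈ Finset.range r, (polyAct M)^[j] f
        ∈ Ideal.span {f | f ∈ I ∧ polyAct M f = f} :=
      Ideal.subset_span ⟨sum_mem fun j _ => (hiter j f hf).1, hfix⟩
    have h2 : ∑ j ∈ Finset.range r, ((polyAct M)^[j] f - f) ∈ idealPlus k m • I :=
      sum_mem fun j _ => (hiter j f hf).2
    have h3 := Ideal.mul_mem_left _ (C (r : k)⁻¹)
      (sub_mem (Ideal.mem_sup_left h1) (Ideal.mem_sup_right h2))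
    rwa [Finset.sum_sub_distrib, sub_sub_cancel, Finset.sum_const, Finset.card_range,
      ← Nat.cast_smul_eq_nsmul k, smul_eq_C_mul, ← mul_assoc, ← C_mul,
      inv_mul_cancel₀ (Nat.cast_ne_zero.2 hr), C_1, one_mul] at h3
  obtain ⟨a, ha, ha'⟩ := Submodule.exists_sub_one_mem_and_smul_le_of_fg_of_le_sup
    (IsNoetherian.noetherian I) le_rfl hle
  exact ⟨a, ha, fun f hf => ha' (Submodule.smul_mem_pointwise_smul f a _ hf)⟩

/-- The image of `M - 1` is tangent to the zero locus of `I` at a fixed point of `M`. -/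
lemma tangentEval_mulVec_sub_eq_zero {M : Matrix (Fin m) (Fin m) k} {x : Fin m → k}
    (hx : M *ᵥ x = x) {I : Ideal (MvPolynomial (Fin m) k)} (hIx : ∀ f ∈ I, eval x f = 0)
    {a : MvPolynomial (Fin m) k} (hax : eval x a ≠ 0)
    (ha : ∀ f ∈ I, a * f ∈ Ideal.span {f | f ∈ I ∧ polyAct M f = f}) (y : Fin m → k)
    {f : MvPolynomial (Fin m) k} (hf : f ∈ I) : tangentEval x (M *ᵥ y - y) f = 0 := by
  have hle : Ideal.span {f | f ∈ I ∧ polyAct M f = f}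
      ≤ RingHom.ker (tangentEval x (M *ᵥ y - y)) := by
    refine Ideal.span_le.2 fun f hf => ?_
    refine TrivSqZeroExt.ext ?_ ?_
    · rw [fst_tangentEval, hIx f hf.1, TrivSqZeroExt.fst_zero]
    · rw [snd_tangentEval_sub, ← tangentEval_polyAct hx, hf.2, sub_self, TrivSqZeroExt.snd_zero]
  have h1 := RingHom.mem_ker.1 (hle (ha f hf))
  rw [map_mul] at h1
  have hunit : IsUnit (tangentEval x (M *ᵥ y - y) a) := by
    rw [TrivSqZeroExt.isUnit_iff_isUnit_fst, isUnit_iff_ne_zero, fst_tangentEval]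
    exact hax
  exact hunit.mul_right_eq_zero.1 h1

end Conormal

section Stabilizer

open Matrix

variable {n : ℕ} {α ℓ : Fin n → k}

lemma exists_character [CharZero k] (h : ℓ ⬝ᵥ α = 1)
    (Γ : Subgroup (GeneralLinearGroup (Fin n) k)) [Finite Γ]
    (hΓ : ∀ g : Γ, ∀ x, ℓ ⬝ᵥ x = 0 → matOf g *ᵥ x = x) {s : Γ} {z : k} (hz : z ≠ 1)
    (hs : matOf s = dilation α ℓ z) :
    ∃ χ : Γ →* k, Function.Injective χ ∧ ∀ g, matOf g = dilation α ℓ (χ g) := by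
  have hone : matOf (1 : Γ) = 1 := rfl
  have hmul : ∀ g g' : Γ, matOf (g * g') = matOf g * matOf g' := fun _ _ => rfl
  have hmpow : ∀ (g : Γ) (j : ℕ), matOf (g ^ j) = matOf g ^ j := fun _ _ => by simp [matOf]
  have hinj : Function.Injective (matOf : Γ → Matrix (Fin n) (Fin n) k) := fun a b hab =>
    Subtype.ext (Units.ext hab)
  have happ : ∀ (g : Γ) x, matOf g *ᵥ x = x + (ℓ ⬝ᵥ x) • (matOf g *ᵥ α - α) := fun g x => by
    have := hΓ g (x - (ℓ ⬝ᵥ x) • α) (by simp [h])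
    rw [mulVec_sub, mulVec_smul, sub_eq_iff_eq_add] at this
    rw [this]
    module
  let χ : Γ →* k :=
    { toFun := fun g => ℓ ⬝ᵥ (matOf g *ᵥ α)
      map_one' := by rw [hone, one_mulVec, h]
      map_mul' := fun g g' => by
        rw [hmul, ← mulVec_mulVec, happ g, dotProduct_add, dotProduct_smul, dotProduct_sub, h,
          smul_eq_mul]
        ring }
  have hχ : ∀ g, χ g = ℓ ⬝ᵥ (matOf g *ᵥ α) := fun _ => rfl
  have hχinj : Function.Injective χ := by
    rw [injective_iff_map_eq_one]
    intro g hg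
    have hg1 : matOf g - 1 = vecMulVec (matOf g *ᵥ α - α) ℓ := by
      refine ext_of_mulVec_single fun i => ?_
      rw [sub_mulVec, one_mulVec, happ, add_sub_cancel_left, vecMulVec_mulVec]
      ext j
      simp [mul_comm]
    have hsq : (matOf g - 1) ^ 2 = 0 := by
      rw [hg1, pow_two, vecMulVec_mul_vecMulVec, dotProduct_sub, h, ← hχ, hg, sub_self, zero_smul,
        vecMulVec_zero]
    obtain ⟨h', hh'⟩ := exists_one_add_nsmul_pow (matOf g) (Nat.card Γ)
    have hpow : matOf g ^ Nat.card Γ = 1 := by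
      have := congrArg matOf (pow_card_eq_one' (x := g))
      rwa [hone, hmpow] at this
    rw [hpow, hsq, zero_mul, add_zero, left_eq_add, ← Nat.cast_smul_eq_nsmul k, smul_eq_zero,
      Nat.cast_eq_zero] at hh'
    exact hinj (sub_eq_zero.1 (hh'.resolve_left Nat.card_pos.ne'))
  refine ⟨χ, hχinj, fun g => ?_⟩
  have hcomm : s * g = g * s := hχinj (by rw [map_mul, map_mul, mul_comm])
  have hα : matOf g *ᵥ α = χ g • α := by
    have h1 := congrArg (fun g => matOf g *ᵥ α) hcomm
    simp only [hmul, ← mulVec_mulVec] at h1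
    rw [hs, dilation_mulVec, dilation_mulVec, h, mulVec_add, mulVec_smul, ← hχ] at h1
    have h2 : (z - 1) • (matOf g *ᵥ α) = (z - 1) • (χ g • α) := by
      rw [smul_smul]
      simpa using h1.symm
    exact smul_right_injective _ (sub_ne_zero.2 hz) h2
  refine ext_of_mulVec_single fun i => ?_
  rw [happ, hα, dilation_mulVec]
  module

lemma exists_eval_ne_zero_of_forall [CharZero k] (h : ℓ ⬝ᵥ α = 1)
    (s : Finset (MvPolynomial (Fin n) k))
    (hs : ∀ f ∈ s, ∃ x, ℓ ⬝ᵥ x = 0 ∧ eval x f ≠ 0) :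
    ∃ v, ℓ ⬝ᵥ v = 0 ∧ ∀ f ∈ s, eval v f ≠ 0 := by
  have hne : ∏ f ∈ s, polyAct (dilation α ℓ 0) f ≠ 0 := by
    refine Finset.prod_ne_zero_iff.2 fun f hf h0 => ?_
    obtain ⟨x, hx, hfx⟩ := hs f hf
    have h1 := eval_polyAct (dilation α ℓ 0) x f
    rw [h0, dilation_mulVec, hx, mul_zero, zero_smul, add_zero, map_zero] at h1
    exact hfx h1.symm
  obtain ⟨x, hx⟩ : ∃ x, eval x (∏ f ∈ s, polyAct (dilation α ℓ 0) f) ≠ 0 := by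
    by_contra! h0
    exact hne (MvPolynomial.funext fun x => by rw [h0 x, map_zero])
  refine ⟨dilation α ℓ 0 *ᵥ x, ?_, fun f hf h0 => hx ?_⟩
  · rw [dilation_mulVec, dotProduct_add, dotProduct_smul, h]
    simp
  · rw [map_prod]
    exact Finset.prod_eq_zero hf (by rw [eval_polyAct, h0])

/-- A generic point of the hyperplane `ℓ = 0` has stabilizer `G ⊓ Γ`, where `Γ` is the pointwise
stabilizer of the hyperplane. -/
lemma exists_generic_point [CharZero k] (h : ℓ ⬝ᵥ α = 1)
    (G Γ : Subgroup (GeneralLinearGroup (Fin n) k)) [Finite G]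
    (hΓ : ∀ g ∈ G, g ∈ Γ ↔ ∀ x, ℓ ⬝ᵥ x = 0 → (g : Matrix (Fin n) (Fin n) k) *ᵥ x = x)
    {f : MvPolynomial (Fin n) k} (hf : eval 0 f ≠ 0) :
    ∃ v, ℓ ⬝ᵥ v = 0 ∧ eval v f ≠ 0 ∧
      ∀ g ∈ G, g ∈ Γ ↔ (g : Matrix (Fin n) (Fin n) k) *ᵥ v = v := by
  classical
  have hex : ∀ g : G, ∃ q : MvPolynomial (Fin n) k, (∃ x, ℓ ⬝ᵥ x = 0 ∧ eval x q ≠ 0) ∧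
      ((g : GeneralLinearGroup (Fin n) k) ∉ Γ → ∀ v, eval v q ≠ 0 → matOf g *ᵥ v ≠ v) := by
    intro g
    by_cases hg : (g : GeneralLinearGroup (Fin n) k) ∈ Γ
    · exact ⟨1, ⟨0, by simp⟩, fun h => absurd hg h⟩
    · rw [hΓ g g.2] at hg
      push Not at hg
      obtain ⟨x, hx, hgx⟩ := hg
      obtain ⟨i, hi⟩ := Function.ne_iff.1 hgx
      refine ⟨polyAct (matOf g) (X i) - X i, ⟨x, hx, ?_⟩, fun _ v hv hgv => hv ?_⟩
      · rw [map_sub, eval_polyAct, eval_X, eval_X]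
        exact sub_ne_zero.2 hi
      · rw [map_sub, eval_polyAct, hgv, sub_self]
  choose q hq hq' using hex
  have := Fintype.ofFinite G
  obtain ⟨v, hv, hv'⟩ := exists_eval_ne_zero_of_forall h (insert f (Finset.univ.image q)) (by
    intro f' hf'
    rcases Finset.mem_insert.1 hf' with rfl | hf'
    · exact ⟨0, by simp, hf⟩
    · obtain ⟨g, _, rfl⟩ := Finset.mem_image.1 hf'
      exact hq g)
  refine ⟨v, hv, hv' f (Finset.mem_insert_self _ _), fun g hg => ⟨fun hgΓ => ?_, fun hgv => ?_⟩⟩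
  · exact (hΓ g hg).1 hgΓ v hv
  · by_contra hgΓ
    exact hq' ⟨g, hg⟩ hgΓ v (hv' _ (Finset.mem_insert_of_mem
      (Finset.mem_image_of_mem q (Finset.mem_univ (⟨g, hg⟩ : G))))) hgv

end Stabilizer

section Quotient

open Matrix

variable {n m : ℕ} {α ℓ v : Fin n → k} {p : Fin m → MvPolynomial (Fin n) k} {e : ℕ} {z : k}
  {M : Matrix (Fin m) (Fin m) k} {w : Fin m → k}

lemma snd_tangentEval_polyAct_X_sub (x y : Fin m → k) (i : Fin m) :
    (tangentEval x y (polyAct M (X i) - X i)).snd = (M *ᵥ y - y) i := by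
  rw [map_sub, TrivSqZeroExt.snd_sub, polyAct_X, map_sum]
  simp_rw [map_smul, tangentEval_X]
  simp [mulVec, dotProduct, TrivSqZeroExt.snd_sum]

lemma mulVec_sub_mem_span [CharZero k] (G : Subgroup (GeneralLinearGroup (Fin n) k)) [Fintype G]
    {Γ : Subgroup (GeneralLinearGroup (Fin n) k)}
    (hv : ∀ g ∈ G, g ∈ Γ ↔ (g : Matrix (Fin n) (Fin n) k) *ᵥ v = v) (hΓ : Γ ≤ G)
    (hℓv : ℓ ⬝ᵥ v = 0) (he : e ≠ 0) (hproj : ∀ i, projCoord α ℓ v i ∈ invariants Γ)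
    (hpow : linForm ℓ ^ e ∈ invariants Γ) (hgen : Algebra.adjoin k (Set.range p) = invariants G)
    {S : Matrix (Fin n) (Fin n) k} (hSM : ∀ i, polyAct S (p i) = ∑ j, M i j • p j)
    (hw : ∀ i, polyAct S (p i) - p i - C (w i) * linForm ℓ ^ e ∈ locIdeal α ℓ v e ^ 2)
    {y : Fin m → k} (hy : ∀ F, aeval p F = 0 → tangentEval (pMap p v) y F = 0) :
    ∃ b : k, M *ᵥ y - y = b • w := by
  have key : ∀ F : MvPolynomial (Fin m) k, aeval p F ∈ locIdeal α ℓ v e ^ 2 →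
      (tangentEval (pMap p v) y F).snd = 0 := fun F hF => by
    rw [eq_zero_of_aeval_mem_sq G hv hΓ hℓv he hproj hpow _ hgen
      (fun F => by rw [fst_tangentEval, eval_aeval]) hy hF, TrivSqZeroExt.snd_zero]
  have haeval : ∀ i, aeval p (polyAct M (X i) - X i) = polyAct S (p i) - p i := fun i => by
    rw [map_sub, aeval_polyAct hSM, aeval_X]
  have hcross : ∀ i j, w j * (M *ᵥ y - y) i = w i * (M *ᵥ y - y) j := fun i j => by
    have := key (w j • (polyAct M (X i) - X i) - w i • (polyAct M (X j) - X j)) (by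
      have h1 := sub_mem (Ideal.mul_mem_left _ (C (w j)) (hw i))
        (Ideal.mul_mem_left _ (C (w i)) (hw j))
      rw [map_sub, map_smul, map_smul, haeval, haeval, smul_eq_C_mul, smul_eq_C_mul]
      convert h1 using 1
      ring)
    rw [map_sub, map_smul, map_smul, TrivSqZeroExt.snd_sub, TrivSqZeroExt.snd_smul,
      TrivSqZeroExt.snd_smul, snd_tangentEval_polyAct_X_sub, snd_tangentEval_polyAct_X_sub] at this
    exact sub_eq_zero.1 this
  by_cases hw0 : w = 0
  · refine ⟨0, _root_.funext fun i => ?_⟩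
    have := key (polyAct M (X i) - X i) (by
      rw [haeval]
      simpa [hw0] using hw i)
    rw [snd_tangentEval_polyAct_X_sub] at this
    rw [this, zero_smul, Pi.zero_apply]
  · obtain ⟨j, hj⟩ := Function.ne_iff.1 hw0
    refine ⟨(w j)⁻¹ * (M *ᵥ y - y) j, _root_.funext fun i => ?_⟩
    rw [Pi.smul_apply, smul_eq_mul, mul_assoc, mul_comm _ (w i), ← hcross i j,
      inv_mul_cancel_left₀ hj]

lemma mulVec_eq_smul_of_expansion [CharZero k] (h : ℓ ⬝ᵥ α = 1) (hℓv : ℓ ⬝ᵥ v = 0) (he : e ≠ 0)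
    (hSM : ∀ i, polyAct (dilation α ℓ z) (p i) = ∑ j, M i j • p j)
    (hw : ∀ i, polyAct (dilation α ℓ z) (p i) - p i - C (w i) * linForm ℓ ^ e
      ∈ locIdeal α ℓ v e ^ 2) : M *ᵥ w = z ^ e • w := by
  refine _root_.funext fun i => sub_eq_zero.1 ?_
  have hJ : (locIdeal α ℓ v e ^ 2).map (polyAct (dilation α ℓ z)) ≤ locIdeal α ℓ v e ^ 2 := by
    rw [Ideal.map_pow]
    exact Ideal.pow_right_mono (polyAct_mem_locIdeal h z e) 2
  refine eq_zero_of_C_mul_linForm_pow_mem h hℓv (e := e) (N := e * 2) (by omega)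
    (map_locIdeal_pow_le h hℓv e 2) ?_
  have h1 := hJ (Ideal.mem_map_of_mem _ (hw i))
  have h2 : ∑ j, C (M i j) * (polyAct (dilation α ℓ z) (p j) - p j - C (w j) * linForm ℓ ^ e)
      ∈ locIdeal α ℓ v e ^ 2 := sum_mem fun j _ => Ideal.mul_mem_left _ _ (hw j)
  convert sub_mem h1 h2 using 1
  have h3 : ∑ j, C (M i j) * p j = polyAct (dilation α ℓ z) (p i) := by
    rw [hSM]
    simp_rw [smul_eq_C_mul]
  have h4 : ∑ j, C (M i j) * polyAct (dilation α ℓ z) (p j)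
      = polyAct (dilation α ℓ z) (polyAct (dilation α ℓ z) (p i)) := by
    rw [← h3, map_sum]
    simp_rw [map_mul, ← algebraMap_eq, AlgHom.commutes]
  simp_rw [mul_sub, Finset.sum_sub_distrib, ← mul_assoc, ← Finset.sum_mul, h3, h4]
  rw [map_sub, map_sub, map_mul, map_pow, polyAct_linForm h]
  simp_rw [← algebraMap_eq, AlgHom.commutes, algebraMap_eq]
  simp [mulVec, dotProduct, mul_pow]
  ring

/-- A dilation outside the hyperplane stabilizer of `G` moves some `G`-invariant. -/
lemma pow_eq_one_of_forall_invariants [CharZero k] (h : ℓ ⬝ᵥ α = 1)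
    (G : Subgroup (GeneralLinearGroup (Fin n) k)) [Fintype G]
    {Γ : Subgroup (GeneralLinearGroup (Fin n) k)}
    (hv : ∀ g ∈ G, g ∈ Γ ↔ (g : Matrix (Fin n) (Fin n) k) *ᵥ v = v) (hΓ : Γ ≤ G)
    (hℓv : ℓ ⬝ᵥ v = 0) (hpow : linForm ℓ ^ e ∈ invariants Γ)
    (hfix : ∀ f ∈ invariants G, polyAct (dilation α ℓ z) f = f) : z ^ e = 1 := by
  obtain ⟨c, h1, h2⟩ := exists_bump G hv (e + 1)
  have hJ : (locIdeal α ℓ v 1 ^ (e + 1)).map (polyAct (dilation α ℓ z))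
      ≤ locIdeal α ℓ v 1 ^ (e + 1) := by
    rw [Ideal.map_pow]
    exact Ideal.pow_right_mono (polyAct_mem_locIdeal h z 1) _
  have hmem := Ideal.pow_right_mono (ker_eval_le (α := α) (ℓ := ℓ)) _
    (orbitSum_bump_sub_mem G hΓ h1 h2 hpow)
  have hmem' := sub_mem hmem (hJ (Ideal.mem_map_of_mem _ hmem))
  have : Finite Γ := Finite.of_injective _ (Subgroup.inclusion_injective hΓ)
  have hcard : (Nat.card Γ : k) ≠ 0 := Nat.cast_ne_zero.2 Nat.card_pos.ne'
  have h0 : (Nat.card Γ : k) * (z ^ e - 1) = 0 := by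
    refine eq_zero_of_C_mul_linForm_pow_mem h hℓv (e := e) (N := 1 * (e + 1)) (by omega)
      (map_locIdeal_pow_le h hℓv 1 (e + 1)) ?_
    convert hmem' using 1
    have h3 : polyAct (dilation α ℓ z) (C (Nat.card Γ : k) * linForm ℓ ^ e)
        = C (Nat.card Γ : k) * (C z * linForm ℓ) ^ e := by
      rw [map_mul, map_pow, polyAct_linForm h, ← algebraMap_eq, AlgHom.commutes]
    rw [map_sub, hfix _ (orbitSum_mem G _), h3, C_mul, C_sub, C_pow, C_1]
    ring
  exact sub_eq_zero.1 ((mul_eq_zero.1 h0).resolve_left hcard)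

end Quotient

section QuotSetup

open Matrix

variable {n m : ℕ}

lemma mem_of_pow_card_eq_one {C : Type*} [Group C] [Finite C] [IsCyclic C] (Δ : Subgroup C)
    {x : C} (hx : x ^ Nat.card Δ = 1) : x ∈ Δ := by
  classical
  have := Fintype.ofFinite C
  have hle : (Finset.univ.filter (· ∈ Δ) : Finset C)
      ⊆ Finset.univ.filter (· ^ Nat.card Δ = 1) := fun y hy => by
    rw [Finset.mem_filter] at hy ⊢
    exact ⟨hy.1, congrArg Subtype.val (pow_card_eq_one' (x := (⟨y, hy.2⟩ : Δ)))⟩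
  have hcard : (Finset.univ.filter (· ∈ Δ) : Finset C).card = Nat.card Δ := by
    rw [Nat.card_eq_fintype_card, ← Fintype.card_subtype]
  have heq := Finset.eq_of_subset_of_card_le hle
    ((IsCyclic.card_pow_eq_one_le Nat.card_pos).trans hcard.ge)
  have hx' : x ∈ (Finset.univ.filter (· ^ Nat.card Δ = 1) : Finset C) := by simpa using hx
  rw [← heq] at hx'
  exact (Finset.mem_filter.1 hx').2

lemma invariants_anti {Γ G : Subgroup (GeneralLinearGroup (Fin n) k)} (h : Γ ≤ G) :
    invariants G ≤ invariants Γ := fun _ hf g hg => hf g (h hg)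

lemma idealPlus_le_ker_eval : idealPlus k m ≤ RingHom.ker (eval (0 : Fin m → k)) :=
  Ideal.span_le.2 (Set.range_subset_iff.2 fun i => by simp)

namespace QuotSetup

variable {Wt G : Subgroup (GeneralLinearGroup (Fin n) k)} {p : Fin m → MvPolynomial (Fin n) k}
  {d : Fin m → ℕ} {c : Wt → Fin m → Fin m → k}

lemma polyAct_matOf (hsetup : QuotSetup Wt G p d c) (s : Wt) (i : Fin m) :
    polyAct (matOf s) (p i) = ∑ j, qMat c s i j • p j := by
  have := hsetup.equivar s⁻¹ i
  rwa [matAct_eq_polyAct, InvMemClass.coe_inv, inv_inv] at this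

lemma pMap_zero (hsetup : QuotSetup Wt G p d c) : pMap p 0 = 0 := by
  refine _root_.funext fun i => ?_
  rw [pMap, eval_zero, constantCoeff_eq]
  exact (hsetup.homog i).coeff_eq_zero (by simpa using (hsetup.dpos i).ne)

lemma qMat_eq_one (hsetup : QuotSetup Wt G p d c) {M : Matrix (Fin m) (Fin m) k}
    (hM : ∀ i, ∑ j, M i j • p j = p i) : M = 1 := by
  refine Matrix.ext fun i => congrFun (sub_eq_zero.1 (hsetup.minimal (fun j => (M - 1) i j) ?_))
  have : ∑ j, (M - 1) i j • p j = 0 := by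
    simp [sub_smul, hM, one_apply]
  rw [this]
  exact zero_mem _

lemma qMat_pow (hsetup : QuotSetup Wt G p d c) (s : Wt) {r : ℕ} (hr : matOf s ^ r = 1) :
    qMat c s ^ r = 1 := by
  refine hsetup.qMat_eq_one fun i => ?_
  have h1 := (Function.Semiconj.iterate_right (f := aeval p) (ga := polyAct (qMat c s))
    (gb := polyAct (matOf s)) (aeval_polyAct (hsetup.polyAct_matOf s)) r) (X i)
  rw [← polyAct_pow, ← polyAct_pow, hr, polyAct_one, aeval_X, polyAct_X, map_sum] at h1
  simpa using h1

lemma exists_qMat_eq_dilation [CharZero k] [Fintype G] (hsetup : QuotSetup Wt G p d c)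
    (hconormal : TrivialConormal Wt p c) {α ℓ : Fin n → k} (h : ℓ ⬝ᵥ α = 1) {s : Wt} {z : k}
    (hs : matOf s = dilation α ℓ z) (hfin : IsOfFinOrder (matOf s))
    {Γ : Subgroup (GeneralLinearGroup (Fin n) k)} (hΓ : Γ ≤ G)
    (hΓ' : ∀ g ∈ G, g ∈ Γ ↔ ∀ x, ℓ ⬝ᵥ x = 0 → (g : Matrix (Fin n) (Fin n) k) *ᵥ x = x)
    (χ : Γ →* k) (hχ : Function.Injective χ) (hχ' : ∀ g, matOf g = dilation α ℓ (χ g))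
    {e : ℕ} (he : e = Nat.card Γ) (hη : z ^ e ≠ 1) :
    ∃ w ψ, ψ ⬝ᵥ w = 1 ∧ qMat c s = dilation w ψ (z ^ e) := by
  have : Finite Γ := Finite.of_injective _ (Subgroup.inclusion_injective hΓ)
  have := Fintype.ofFinite Γ
  have he0 : e ≠ 0 := he ▸ Nat.card_pos.ne'
  have hr0 := hfin.orderOf_pos.ne'
  have hSM := hsetup.polyAct_matOf s
  have hMr := hsetup.qMat_pow s (pow_orderOf_eq_one (matOf s))
  obtain ⟨a, ha1, ha⟩ := exists_mul_mem_span_fixed hr0 hMr (relIdeal p) (hconormal s⁻¹)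
  have ha0 : eval 0 (aeval p a) ≠ 0 := by
    have := idealPlus_le_ker_eval ha1
    rw [RingHom.mem_ker, map_sub, map_one, sub_eq_zero] at this
    rw [eval_aeval, hsetup.pMap_zero, this]
    exact one_ne_zero
  obtain ⟨v, hℓv, hav, hv⟩ := exists_generic_point h G Γ hΓ' ha0
  rw [eval_aeval] at hav
  have hrel : ∀ F ∈ relIdeal p, eval (pMap p v) F = 0 := fun F hF => by
    rw [← eval_aeval, RingHom.mem_ker.1 hF, map_zero]
  have hfix : qMat c s *ᵥ pMap p v = pMap p v := by
    refine _root_.funext fun i => ?_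
    have h1 := congrArg (eval v) (hSM i)
    rw [eval_polyAct, hs, dilation_mulVec, hℓv, mul_zero, zero_smul, add_zero, map_sum] at h1
    simp_rw [smul_eval] at h1
    exact h1.symm
  have hact : ∀ g ∈ Γ, ∃ a : k, a ^ e = 1 ∧ matAct g = polyAct (dilation α ℓ a) := fun g hg => by
    refine ⟨χ ⟨g, hg⟩⁻¹, ?_, ?_⟩
    · rw [← map_pow, he, pow_card_eq_one', map_one]
    · rw [← hχ']
      rfl
  have hproj : ∀ i, projCoord α ℓ v i ∈ invariants Γ := fun i g hg => by
    obtain ⟨a, -, ha⟩ := hact g hg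
    rw [ha, polyAct_projCoord h]
  have hpow : linForm ℓ ^ e ∈ invariants Γ := fun g hg => by
    obtain ⟨a, ha', ha⟩ := hact g hg
    rw [ha, map_pow, polyAct_linForm h, mul_pow, ← C_pow, ha', C_1, one_mul]
  have hp : ∀ i, p i ∈ invariants G := fun i => by
    rw [← hsetup.gen]
    exact Algebra.subset_adjoin ⟨i, rfl⟩
  have hexp : ∀ i, ∃ b, polyAct (dilation α ℓ z) (p i) - p i - C b * linForm ℓ ^ e
      ∈ locIdeal α ℓ v e ^ 2 := fun i => by
    obtain ⟨-, b, -, hb⟩ := exists_expansion h z e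
      (he ▸ mem_adjoin_of_mem_invariants (v := v) h Γ χ hχ hχ' (invariants_anti hΓ (hp i)))
    exact ⟨b, hb⟩
  choose w hw using hexp
  rw [hs] at hSM
  have hMw := mulVec_eq_smul_of_expansion h hℓv he0 hSM hw
  have hrange : ∀ y, ∃ b : k, (qMat c s - 1) *ᵥ y = b • w := fun y => by
    obtain ⟨B, hB⟩ := exists_one_add_nsmul_pow (qMat c s) (orderOf (matOf s))
    have hz : (qMat c s - 1) * ((qMat c s - 1) * B)
        = (-(orderOf (matOf s) : k)) • (qMat c s - 1) := by
      rw [hMr, add_assoc, left_eq_add, pow_two, mul_assoc] at hB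
      rw [eq_neg_of_add_eq_zero_right hB, neg_smul, Nat.cast_smul_eq_nsmul]
    obtain ⟨b, hb⟩ := mulVec_sub_mem_span G hv hΓ hℓv he0 hproj hpow hsetup.gen hSM hw
      (y := qMat c s *ᵥ (B *ᵥ y) - B *ᵥ y)
      (fun F hF => tangentEval_mulVec_sub_eq_zero hfix hrel hav ha _ hF)
    have h1 : (-(orderOf (matOf s) : k)) • ((qMat c s - 1) *ᵥ y) = b • w := by
      rw [← smul_mulVec, ← hz, ← hb]
      simp only [← mulVec_mulVec, sub_mulVec, one_mulVec]
    refine ⟨(-(orderOf (matOf s) : k))⁻¹ * b, ?_⟩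
    rw [mul_smul, ← h1, inv_smul_smul₀ (neg_ne_zero.2 (Nat.cast_ne_zero.2 hr0))]
  obtain ⟨φ, hφ⟩ := vecMulVec_of_range_le hrange
  rw [sub_eq_iff_eq_add'] at hφ
  have hw0 : w ≠ 0 := by
    rintro rfl
    refine hη (pow_eq_one_of_forall_invariants h G hv hΓ hℓv hpow fun f hf => ?_)
    obtain ⟨F, rfl⟩ := exists_aeval_eq hsetup.gen hf
    rw [← aeval_polyAct hSM, hφ, zero_vecMulVec, add_zero, polyAct_one, AlgHom.id_apply]
  have hφw : 1 + φ ⬝ᵥ w = z ^ e := by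
    have h1 : (1 + φ ⬝ᵥ w) • w = z ^ e • w := by
      rw [← hMw, hφ, add_mulVec, one_mulVec, vecMulVec_mulVec, add_smul, one_smul]
      simp
    exact smul_left_injective _ hw0 h1
  obtain ⟨ψ, hψ, hM⟩ := exists_dilation_of_sub_one hφ
    fun h0 => hη (by rw [← hφw, h0, add_zero])
  exact ⟨w, ψ, hψ, by rw [hM, hφw]⟩

end QuotSetup

end QuotSetup

/-- if `G` is good, the quotient map `q : Wt → W` sends a reflection `s`
of order `r` with reflecting hyperplane `H` to the identity if `r ∣ e_H`, and otherwise
to a reflection of `V` of order `r / gcd(r, e_H)` whose determinant on `V` is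
`det(s) ^ (e_H)`. -/
theorem statement5 [CharZero k] {n m : ℕ}
    (Wt G : Subgroup (Matrix.GeneralLinearGroup (Fin n) k))
    (p : Fin m → MvPolynomial (Fin n) k) (d : Fin m → ℕ)
    (c : ↥Wt → Fin m → Fin m → k)
    (hsetup : QuotSetup Wt G p d c)
    (hgood : IsGoodQuot Wt p c)
    (s : ↥Wt) (hrefl : IsReflection (matOf s)) :
    ∀ H : Submodule k (Fin n → k),
      H = LinearMap.ker (Matrix.toLin' (matOf s) - LinearMap.id) →
    ∀ r e : ℕ, r = orderOf (matOf s) → e = eH G H →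
      ((r ∣ e → (s : Matrix.GeneralLinearGroup (Fin n) k) ∈ G)
        ∧ (¬ r ∣ e →
            IsReflection (qMat c s)
            ∧ orderOf (qMat c s) = r / Nat.gcd r e
            ∧ Matrix.det (qMat c s) = Matrix.det (matOf s) ^ e)) := by
  rintro H hH r e rfl he
  obtain ⟨α, ℓ, z, h, hz, hs⟩ := exists_dilation_of_isReflection hrefl
  have hHmem : ∀ x, x ∈ H ↔ dotProduct ℓ x = 0 := fun x => by rw [hH, hs, mem_ker_dilation h hz]
  have : Finite Wt := hsetup.finite.to_subtype
  have : Finite G := Finite.of_injective _ (Subgroup.inclusion_injective hsetup.le)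
  have := Fintype.ofFinite G
  have hfinΓ₀ : Finite ↥(Wt ⊓ pointStab H) :=
    Finite.of_injective _ (Subgroup.inclusion_injective inf_le_left)
  have hsH : (s : Matrix.GeneralLinearGroup (Fin n) k) ∈ pointStab H := fun x hx => by
    change Matrix.mulVec (matOf s) x = x
    rw [hs, dilation_mulVec, (hHmem x).1 hx, mul_zero, zero_smul, add_zero]
  let s₀ : ↥(Wt ⊓ pointStab H) := ⟨s, s.2, hsH⟩
  obtain ⟨χ, hχ, hχ'⟩ := exists_character h (Wt ⊓ pointStab H)
    (fun g x hx => g.2.2 x ((hHmem x).2 hx)) (s := s₀) hz hs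
  have hΓle : G ⊓ pointStab H ≤ Wt ⊓ pointStab H := inf_le_inf_right _ hsetup.le
  have hcard : Nat.card ((G ⊓ pointStab H).subgroupOf (Wt ⊓ pointStab H)) = e := by
    rw [he, eH, Nat.card_congr (Subgroup.subgroupOfEquivOfLe hΓle).toEquiv]
  refine ⟨fun hdvd => ?_, fun hdvd => ?_⟩
  · have := isCyclic_of_injective_ringHom χ hχ
    have hse : s₀ ^ Nat.card ((G ⊓ pointStab H).subgroupOf (Wt ⊓ pointStab H)) = 1 := by
      refine Subtype.ext (Units.ext ?_)
      rw [hcard]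
      simpa [s₀, matOf] using orderOf_dvd_iff_pow_eq_one.1 hdvd
    exact (mem_of_pow_card_eq_one _ hse).1
  have he0 : e ≠ 0 := hcard ▸ Nat.card_pos.ne'
  have hη : z ^ e ≠ 1 := by
    rwa [hs, orderOf_dilation h, orderOf_dvd_iff_pow_eq_one] at hdvd
  obtain ⟨w, ψ, hψ, hM⟩ : ∃ w ψ, dotProduct ψ w = 1 ∧ qMat c s = dilation w ψ (z ^ e) := by
    refine hsetup.exists_qMat_eq_dilation hgood.2 h hs hrefl.1 inf_le_left
      (fun g hg => ?_) (χ.comp (Subgroup.inclusion hΓle))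
      (hχ.comp (Subgroup.inclusion_injective hΓle)) (fun g => hχ' (Subgroup.inclusion hΓle g)) he hη
    simp_rw [Subgroup.mem_inf, hg, true_and, ← hHmem]
    rfl
  have hfin : IsOfFinOrder z := by
    have := hrefl.1
    rwa [hs, ← orderOf_pos_iff, orderOf_dilation h, orderOf_pos_iff] at this
  rw [hM, hs, det_dilation hψ, det_dilation h, orderOf_dilation hψ, orderOf_dilation h]
  refine ⟨isReflection_dilation hψ hη hfin.pow, orderOf_pow' z he0, rfl⟩

end ReflQuot
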